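/- Let θ¹, θ⁰ : ℝ² → ℝ be smooth solutions of the (1+1)-dimensional linear heat equation ∂_{z₁}θ = ∂²_{z₂}θ on ℝ². Then the function u(t,x,y) := y·∂²_{z₂}θ¹(t,x) + (1/4)x²·∂_{z₂}θ¹(t,x) − (1/4)x·θ¹(t,x) + θ⁰(t,x) is a solution of the remarkable Fokker–Planck equation u_t + x u_y = u_xx on all of ℝ³. -/

import Mathlib

/-- ∂_t u -/
noncomputable def dT (u : ℝ → ℝ → ℝ → ℝ) (t x y : ℝ) : ℝ := deriv (fun s => u s x y) t
/-- ∂_y u -/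
noncomputable def dY (u : ℝ → ℝ → ℝ → ℝ) (t x y : ℝ) : ℝ := deriv (fun s => u t x s) y
/-- ∂²_x u -/
noncomputable def dXX (u : ℝ → ℝ → ℝ → ℝ) (t x y : ℝ) : ℝ := deriv (deriv (fun s => u t s y)) x

/-- ∂_{z₁} θ -/
noncomputable def d1 (θ : ℝ → ℝ → ℝ) (z1 z2 : ℝ) : ℝ := deriv (fun s => θ s z2) z1
/-- ∂_{z₂} θ -/
noncomputable def d2 (θ : ℝ → ℝ → ℝ) (z1 z2 : ℝ) : ℝ := deriv (fun s => θ z1 s) z2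
/-- ∂²_{z₂} θ -/
noncomputable def d22 (θ : ℝ → ℝ → ℝ) (z1 z2 : ℝ) : ℝ := deriv (deriv (fun s => θ z1 s)) z2

/-- The solution family from the generalized reduction with respect to ((𝔓⁰)²u)∂_u. -/
noncomputable def sol14 (θ1 θ0 : ℝ → ℝ → ℝ) (t x y : ℝ) : ℝ :=
  y * d22 θ1 t x + (1 / 4) * x ^ 2 * d2 θ1 t x - (1 / 4) * x * θ1 t x + θ0 t x

theorem hasDerivAt_fst_fderiv {θ : ℝ → ℝ → ℝ} {t x : ℝ}
    (h : DifferentiableAt ℝ (fun p : ℝ × ℝ => θ p.1 p.2) (t, x)) :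
    HasDerivAt (fun s => θ s x) (fderiv ℝ (fun p : ℝ × ℝ => θ p.1 p.2) (t, x) (1, 0)) t :=
  h.hasFDerivAt.comp_hasDerivAt (f := fun s : ℝ => (s, x)) t
    ((hasDerivAt_id t).prodMk (hasDerivAt_const t x))

theorem hasDerivAt_snd_fderiv {θ : ℝ → ℝ → ℝ} {t x : ℝ}
    (h : DifferentiableAt ℝ (fun p : ℝ × ℝ => θ p.1 p.2) (t, x)) :
    HasDerivAt (fun s => θ t s) (fderiv ℝ (fun p : ℝ × ℝ => θ p.1 p.2) (t, x) (0, 1)) x :=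
  h.hasFDerivAt.comp_hasDerivAt (f := fun s : ℝ => (t, s)) x
    ((hasDerivAt_const x t).prodMk (hasDerivAt_id x))

theorem d1_eq_fderiv {θ : ℝ → ℝ → ℝ}
    (h : ContDiff ℝ (⊤ : ℕ∞) (fun p : ℝ × ℝ => θ p.1 p.2)) (t x : ℝ) :
    d1 θ t x = fderiv ℝ (fun p : ℝ × ℝ => θ p.1 p.2) (t, x) (1, 0) :=
  (hasDerivAt_fst_fderiv (h.differentiable (by simp) _)).deriv

theorem d2_eq_fderiv {θ : ℝ → ℝ → ℝ}
    (h : ContDiff ℝ (⊤ : ℕ∞) (fun p : ℝ × ℝ => θ p.1 p.2)) (t x : ℝ) :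
    d2 θ t x = fderiv ℝ (fun p : ℝ × ℝ => θ p.1 p.2) (t, x) (0, 1) :=
  (hasDerivAt_snd_fderiv (h.differentiable (by simp) _)).deriv

theorem hasDerivAt_d1 {θ : ℝ → ℝ → ℝ}
    (h : ContDiff ℝ (⊤ : ℕ∞) (fun p : ℝ × ℝ => θ p.1 p.2)) (t x : ℝ) :
    HasDerivAt (fun s => θ s x) (d1 θ t x) t := by
  rw [d1_eq_fderiv h]
  exact hasDerivAt_fst_fderiv (h.differentiable (by simp) _)

theorem hasDerivAt_d2 {θ : ℝ → ℝ → ℝ}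
    (h : ContDiff ℝ (⊤ : ℕ∞) (fun p : ℝ × ℝ => θ p.1 p.2)) (t x : ℝ) :
    HasDerivAt (fun s => θ t s) (d2 θ t x) x := by
  rw [d2_eq_fderiv h]
  exact hasDerivAt_snd_fderiv (h.differentiable (by simp) _)

theorem contDiff_d2 {θ : ℝ → ℝ → ℝ}
    (h : ContDiff ℝ (⊤ : ℕ∞) (fun p : ℝ × ℝ => θ p.1 p.2)) :
    ContDiff ℝ (⊤ : ℕ∞) (fun p : ℝ × ℝ => d2 θ p.1 p.2) := by
  simp only [d2_eq_fderiv h]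
  exact (h.fderiv_right (m := (⊤ : ℕ∞)) (by simp)).clm_apply contDiff_const

theorem contDiff_d1 {θ : ℝ → ℝ → ℝ}
    (h : ContDiff ℝ (⊤ : ℕ∞) (fun p : ℝ × ℝ => θ p.1 p.2)) :
    ContDiff ℝ (⊤ : ℕ∞) (fun p : ℝ × ℝ => d1 θ p.1 p.2) := by
  simp only [d1_eq_fderiv h]
  exact (h.fderiv_right (m := (⊤ : ℕ∞)) (by simp)).clm_apply contDiff_const

/-- Mixed partial derivatives of a smooth function commute. -/
theorem d1_d2_comm {θ : ℝ → ℝ → ℝ}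
    (h : ContDiff ℝ (⊤ : ℕ∞) (fun p : ℝ × ℝ => θ p.1 p.2)) (t x : ℝ) :
    d1 (d2 θ) t x = d2 (d1 θ) t x := by
  have hd : DifferentiableAt ℝ (fderiv ℝ (fun p : ℝ × ℝ => θ p.1 p.2)) (t, x) :=
    (h.fderiv_right (m := (⊤ : ℕ∞)) (by simp)).differentiable (by simp) _
  have hsymm := (h.contDiffAt (x := (t, x))).isSymmSndFDerivAt
    (by simpa using WithTop.coe_le_coe.2 (le_top : (2 : ℕ∞) ≤ ⊤))
  rw [d1_eq_fderiv (contDiff_d2 h), d2_eq_fderiv (contDiff_d1 h)]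
  simp only [d1_eq_fderiv h, d2_eq_fderiv h, Prod.mk.eta]
  rw [fderiv_clm_apply hd (differentiableAt_const _),
    fderiv_clm_apply hd (differentiableAt_const _)]
  simpa using hsymm (1, 0) (0, 1)

theorem d22_eq_d2_d2 (θ : ℝ → ℝ → ℝ) : d22 θ = d2 (d2 θ) := rfl

theorem generalized_reduction_P0 (θ1 θ0 : ℝ → ℝ → ℝ)
    (hθ1 : ContDiff ℝ (⊤ : ℕ∞) (fun p : ℝ × ℝ => θ1 p.1 p.2))
    (hθ0 : ContDiff ℝ (⊤ : ℕ∞) (fun p : ℝ × ℝ => θ0 p.1 p.2))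
    (hheat1 : ∀ z1 z2 : ℝ, d1 θ1 z1 z2 = d22 θ1 z1 z2)
    (hheat0 : ∀ z1 z2 : ℝ, d1 θ0 z1 z2 = d22 θ0 z1 z2) :
    ContDiff ℝ 2 (fun p : ℝ × ℝ × ℝ => sol14 θ1 θ0 p.1 p.2.1 p.2.2) ∧
    ∀ t x y : ℝ,
      dT (sol14 θ1 θ0) t x y + x * dY (sol14 θ1 θ0) t x y
        = dXX (sol14 θ1 θ0) t x y := by
  rw [d22_eq_d2_d2] at hheat1 hheat0
  have hb := contDiff_d2 hθ1
  have hc := contDiff_d2 hb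
  have he := contDiff_d2 hc
  have hq := contDiff_d2 hθ0
  have hheat1' : d1 θ1 = d2 (d2 θ1) := funext₂ hheat1
  have hheat_b : d1 (d2 θ1) = d2 (d2 (d2 θ1)) :=
    funext₂ fun t x => by rw [d1_d2_comm hθ1, hheat1']
  have hheat_c : d1 (d2 (d2 θ1)) = d2 (d2 (d2 (d2 θ1))) :=
    funext₂ fun t x => by rw [d1_d2_comm hb, hheat_b]
  refine ⟨?_, fun t x y => ?_⟩
  · have hp : ContDiff ℝ (⊤ : ℕ∞) (fun p : ℝ × ℝ × ℝ => (p.1, p.2.1)) := by fun_prop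
    have h0 := hθ0.comp hp
    have ha := hθ1.comp hp
    have hb := hb.comp hp
    have hc := hc.comp hp
    simp only [Function.comp_def] at h0 ha hb hc
    simp only [sol14, d22_eq_d2_d2]
    refine ContDiff.of_le (n := (⊤ : ℕ∞)) ?_
      (WithTop.coe_le_coe.2 (le_top : (2 : ℕ∞) ≤ ⊤))
    fun_prop
  · have hT : dT (sol14 θ1 θ0) t x y = y * d2 (d2 (d2 (d2 θ1))) t x
        + (1 / 4) * x ^ 2 * d2 (d2 (d2 θ1)) t x - (1 / 4) * x * d2 (d2 θ1) t x
        + d2 (d2 θ0) t x := by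
      rw [← hheat_c, ← hheat_b, ← hheat1, ← hheat0]
      exact (((((hasDerivAt_d1 hc t x).const_mul y).add
        ((hasDerivAt_d1 hb t x).const_mul ((1 / 4) * x ^ 2))).sub
        ((hasDerivAt_d1 hθ1 t x).const_mul ((1 / 4) * x))).add (hasDerivAt_d1 hθ0 t x)).deriv
    have hY : dY (sol14 θ1 θ0) t x y = d2 (d2 θ1) t x := by
      have := ((((hasDerivAt_id y).mul_const (d2 (d2 θ1) t x)).add_const
        ((1 / 4) * x ^ 2 * d2 θ1 t x)).sub_const ((1 / 4) * x * θ1 t x)).add_const (θ0 t x)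
      exact this.deriv.trans (one_mul _)
    have hsq (s : ℝ) : HasDerivAt (fun s : ℝ => (1 / 4) * s ^ 2) ((1 / 2) * s) s := by
      refine ((hasDerivAt_pow 2 s).const_mul (1 / 4 : ℝ)).congr_deriv ?_
      norm_num
      ring
    have hlin (c s : ℝ) : HasDerivAt (fun s : ℝ => c * s) c s := by
      simpa using (hasDerivAt_id s).const_mul c
    have hX : deriv (fun s => sol14 θ1 θ0 t s y) = fun s => y * d2 (d2 (d2 θ1)) t s
        + ((1 / 2) * s * d2 θ1 t s + (1 / 4) * s ^ 2 * d2 (d2 θ1) t s)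
        - ((1 / 4) * θ1 t s + (1 / 4) * s * d2 θ1 t s) + d2 θ0 t s :=
      funext fun s => (((((hasDerivAt_d2 hc t s).const_mul y).add
        ((hsq s).mul (hasDerivAt_d2 hb t s))).sub
        ((hlin (1 / 4) s).mul (hasDerivAt_d2 hθ1 t s))).add (hasDerivAt_d2 hθ0 t s)).deriv
    have hXX := (((((hasDerivAt_d2 he t x).const_mul y).add
        (((hlin (1 / 2) x).mul (hasDerivAt_d2 hb t x)).add
          ((hsq x).mul (hasDerivAt_d2 hc t x)))).sub
        (((hasDerivAt_d2 hθ1 t x).const_mul (1 / 4)).add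
          ((hlin (1 / 4) x).mul (hasDerivAt_d2 hb t x)))).add (hasDerivAt_d2 hq t x)).deriv
    rw [hT, hY, dXX, hX]
    refine Eq.trans ?_ hXX.symm
    ring
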